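/- arXiv:1805.05174 — 4 statements merged into one kernel-verified Lean document; each statement's English description precedes it below -/
import Mathlib

section
/- Let R be a Dedekind domain with field of fractions K and let A be a finite-dimensional semisimple K-algebra. Let H ⊆ H̃ ⊆ A be R-subalgebras of A such that H is finitely generated as an R-module and spans A over K, and H̃ is finitely generated as an R-module. If H is left hereditary (every left ideal of H is projective as a left H-module), then H̃ is left hereditary as well. -/
set_option synthInstance.maxHeartbeats 1000000
set_option maxHeartbeats 1000000

/-- Projectivity descends along `S → T` to a `T`-module whenever some `z : S` acts injectively
on `T` and conducts `T` into the image of `S`. -/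
theorem Module.Projective.of_conductor {S T M : Type*} [Ring S] [Ring T] [Module S T]
    [IsScalarTower S T T] [AddCommGroup M] [Module S M] [Module T M] [IsScalarTower S T M]
    (z : S) (hz : Function.Injective fun t : T => z • t)
    (hc : ∀ t : T, ∃ c : S, c • (1 : T) = z • t) [Module.Projective S M] :
    Module.Projective T M := by
  obtain ⟨s, hs⟩ := Module.projective_def'.1 (inferInstance : Module.Projective S M)
  let f : M →ₗ[S] (M →₀ T) :=
    (Finsupp.mapRange.linearMap (LinearMap.toSpanSingleton S T 1)).comp s
  have hf (t : T) (m : M) : f (t • m) = t • f m := by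
    obtain ⟨c, hct⟩ := hc t
    have h : z • f (t • m) = z • t • f m := by
      rw [← map_smul, ← smul_assoc, ← hct, smul_assoc, one_smul, map_smul, ← smul_assoc, ← hct,
        smul_assoc, one_smul]
    ext n
    exact hz (DFunLike.congr_fun h n)
  let g : M →ₗ[T] (M →₀ T) := { toFun := f, map_add' := map_add f, map_smul' := hf }
  refine Module.projective_def'.2 ⟨g, LinearMap.ext fun m => ?_⟩
  have hm : Finsupp.linearCombination S id (s m) = m := LinearMap.congr_fun hs m
  change Finsupp.linearCombination T id (f m) = m
  conv_rhs => rw [← hm]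
  simp only [f, LinearMap.comp_apply, Finsupp.mapRange.linearMap_apply,
    Finsupp.linearCombination_apply]
  rw [Finsupp.sum_mapRange_index (by simp)]
  simp [smul_assoc]

/-- A module embedding into a left hereditary ring is projective. -/
theorem Module.Projective.of_injective_of_hereditary {S M : Type*} [Ring S] [AddCommGroup M]
    [Module S M] (hS : ∀ I : Ideal S, Module.Projective S I) (f : M →ₗ[S] S)
    (hf : Function.Injective f) : Module.Projective S M :=
  have := hS (LinearMap.range f)
  .of_equiv (LinearEquiv.ofInjective f hf).symm

/-- An element of a `K`-space spanned by an `R`-submodule `N` has a nonzero `R`-multiple in `N`,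
where `K` is the fraction field of `R`. -/
theorem Submodule.exists_ne_zero_smul_mem_of_span_eq_top {R K V : Type*} [CommRing R] [IsDomain R]
    [Field K] [Algebra R K] [IsFractionRing R K] [AddCommGroup V] [Module K V] [Module R V]
    [IsScalarTower R K V] (N : Submodule R V) (hN : Submodule.span K (N : Set V) = ⊤) (v : V) :
    ∃ r : R, r ≠ 0 ∧ r • v ∈ N := by
  have hv : v ∈ Submodule.span K (N : Set V) := hN ▸ Submodule.mem_top
  induction hv using Submodule.span_induction with
  | mem x hx => exact ⟨1, one_ne_zero, by simpa using hx⟩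
  | zero => exact ⟨1, one_ne_zero, by simp⟩
  | add x y _ _ hx hy =>
    obtain ⟨a, ha, hax⟩ := hx
    obtain ⟨b, hb, hby⟩ := hy
    refine ⟨a * b, mul_ne_zero ha hb, ?_⟩
    rw [smul_add]
    refine N.add_mem ?_ ?_
    · rw [mul_comm, mul_smul]; exact N.smul_mem _ hax
    · rw [mul_smul]; exact N.smul_mem _ hby
  | smul k x _ hx =>
    obtain ⟨a, ha, hax⟩ := hx
    obtain ⟨p, q, hq, rfl⟩ := IsFractionRing.div_surjective (A := R) k
    have hq0 : algebraMap R K q ≠ 0 := IsFractionRing.to_map_ne_zero_of_mem_nonZeroDivisors hq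
    refine ⟨q * a, mul_ne_zero (nonZeroDivisors.ne_zero hq) ha, ?_⟩
    have h : (q * a) • (algebraMap R K p / algebraMap R K q) • x = p • a • x := by
      simp only [← algebraMap_smul K (_ : R) (_ : V), smul_smul, map_mul]
      congr 1
      field_simp
    rw [h]
    exact N.smul_mem _ hax

/-- Pointwise denominators with values in `N` of a finitely generated module can be chosen
uniformly. -/
theorem Submodule.exists_ne_zero_forall_smul_mem {R V : Type*} [CommRing R] [IsDomain R]
    [AddCommGroup V] [Module R V] (N P : Submodule R V) (hP : P.FG)
    (h : ∀ v : V, ∃ r : R, r ≠ 0 ∧ r • v ∈ N) : ∃ r : R, r ≠ 0 ∧ ∀ v ∈ P, r • v ∈ N := by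
  induction P, hP using Submodule.fg_induction with
  | singleton x =>
    obtain ⟨r, hr, hx⟩ := h x
    refine ⟨r, hr, fun v hv => ?_⟩
    obtain ⟨a, rfl⟩ := Submodule.mem_span_singleton.1 hv
    rw [smul_comm]
    exact N.smul_mem _ hx
  | sup P Q _ _ hP hQ =>
    obtain ⟨a, ha, hP⟩ := hP
    obtain ⟨b, hb, hQ⟩ := hQ
    refine ⟨a * b, mul_ne_zero ha hb, fun v hv => ?_⟩
    obtain ⟨x, hx, y, hy, rfl⟩ := Submodule.mem_sup.1 hv
    rw [smul_add]
    refine N.add_mem ?_ ?_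
    · rw [mul_comm, mul_smul]; exact N.smul_mem _ (hP x hx)
    · rw [mul_smul]; exact N.smul_mem _ (hQ y hy)

/-- Let `R` be a Dedekind domain with fraction field `K` and `A` a
finite-dimensional semisimple `K`-algebra.  If `H ⊆ H̃ ⊆ A` are `R`-subalgebras with `H`
an `R`-order (finitely generated over `R`, spanning `A` over `K`), `H̃` finitely generated
over `R`, and `H` left hereditary, then `H̃` is left hereditary as well. -/
theorem statement7 {R : Type*} [CommRing R] [IsDomain R] [IsDedekindDomain R]
    {K : Type*} [Field K] [Algebra R K] [IsFractionRing R K]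
    {A : Type*} [Ring A] [Algebra K A] [FiniteDimensional K A] [IsSemisimpleRing A]
    [Algebra R A] [IsScalarTower R K A]
    (H Htilde : Subalgebra R A) (hle : H ≤ Htilde)
    (hfin : Module.Finite R H)
    (hspan : Submodule.span K (H : Set A) = ⊤)
    (hfin' : Module.Finite R Htilde)
    (hher : ∀ I : Ideal H, Module.Projective H I) :
    ∀ I : Ideal Htilde, Module.Projective Htilde I := by
  intro I
  obtain ⟨r, hr, hrH⟩ := Submodule.exists_ne_zero_forall_smul_mem (Subalgebra.toSubmodule H)
    (Subalgebra.toSubmodule Htilde) (Module.Finite.iff_fg.1 hfin')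
    (Submodule.exists_ne_zero_smul_mem_of_span_eq_top (K := K) _ hspan)
  have hinj : Function.Injective fun a : A => r • a := by
    have hr' : algebraMap R K r ≠ 0 := by simpa using hr
    intro a b hab
    simp only [← algebraMap_smul K r] at hab
    exact smul_right_injective A hr' hab
  let φ := Subalgebra.inclusion hle
  let _ : Module H Htilde := Module.compHom Htilde (φ : H →+* Htilde)
  let _ : Module H I := Module.compHom I (φ : H →+* Htilde)
  have smul_def (c : H) (t : Htilde) : c • t = φ c * t := rfl
  have : IsScalarTower H Htilde Htilde := ⟨fun c t t' => mul_assoc (φ c) t t'⟩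
  have : IsScalarTower H Htilde I := ⟨fun c t x => mul_smul (φ c) t x⟩
  let e : I →ₗ[H] H :=
    { toFun := fun x => ⟨r • (x : Htilde), hrH _ (x : Htilde).2⟩
      map_add' := fun x y => Subtype.ext (smul_add r ((x : Htilde) : A) (y : Htilde))
      map_smul' := fun c x => Subtype.ext (mul_smul_comm r (c : A) (x : Htilde)).symm }
  have he : Function.Injective e := fun x y hxy =>
    Subtype.ext (Subtype.ext (hinj (congrArg Subtype.val hxy)))
  have := Module.Projective.of_injective_of_hereditary hher e he
  have hz (t : Htilde) : ((algebraMap R H r • t : Htilde) : A) = r • (t : A) :=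
    (Algebra.smul_def r (t : A)).symm
  refine Module.Projective.of_conductor (algebraMap R H r) (fun t t' h => ?_) fun t => ?_
  · refine Subtype.ext (hinj ?_)
    simpa only [hz] using congrArg Subtype.val h
  · refine ⟨⟨r • (t : A), hrH _ t.2⟩, Subtype.ext ?_⟩
    rw [hz, smul_def, mul_one]
    rfl
end

section
/- Let R be a Dedekind domain with field of fractions K, A a finite-dimensional semisimple K-algebra, and H ⊆ A an R-order in A (an R-subalgebra finitely generated as an R-module whose K-linear span is A) which is left hereditary (every left ideal of H is projective as a left H-module). Let P be a finitely generated projective left H-module and let H′ := (End_H(P))^op be the corresponding minor of H. Then H′ is left hereditary: every left ideal of H′ is projective as a left H′-module. -/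
set_option synthInstance.maxHeartbeats 1000000
set_option maxHeartbeats 1000000

/-- A module is projective if it admits a linear map with projective kernel and range. -/
theorem Module.Projective.of_ker_range {S M N : Type*} [Ring S] [AddCommGroup M] [Module S M]
    [AddCommGroup N] [Module S N] (f : M →ₗ[S] N) (hker : Module.Projective S (LinearMap.ker f))
    (hrange : Module.Projective S (LinearMap.range f)) : Module.Projective S M := by
  obtain ⟨s, hs⟩ := Module.projective_lifting_property f.rangeRestrict LinearMap.id
    f.surjective_rangeRestrict
  have hs' (y : LinearMap.range f) : f (s y) = y := congr_arg Subtype.val (LinearMap.congr_fun hs y)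
  refine Module.Projective.of_split
    (LinearMap.prod (LinearMap.codRestrict (LinearMap.ker f)
      (LinearMap.id - s ∘ₗ f.rangeRestrict) fun x ↦ by simp [hs']) f.rangeRestrict)
    (LinearMap.coprod (LinearMap.ker f).subtype s) ?_
  ext x
  simp

/-- Over a left hereditary ring, submodules of finite free modules are projective. -/
theorem Submodule.projective_of_forall_ideal_pi {S : Type*} [Ring S]
    (hS : ∀ I : Ideal S, Module.Projective S I) (n : ℕ) (N : Submodule S (Fin n → S)) :
    Module.Projective S N := by
  induction n with
  | zero => infer_instance
  | succ n ih =>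
    refine Module.Projective.of_ker_range (LinearMap.proj 0 ∘ₗ N.subtype) ?_ (hS _)
    set K := LinearMap.ker (LinearMap.proj 0 ∘ₗ N.subtype)
    let g : K →ₗ[S] (Fin n → S) := LinearMap.funLeft S S Fin.succ ∘ₗ N.subtype ∘ₗ K.subtype
    have hg : Function.Injective g := by
      intro x y h
      ext i
      refine Fin.cases ?_ (fun i ↦ congr_fun h i) i
      exact (LinearMap.mem_ker.mp x.2).trans (LinearMap.mem_ker.mp y.2).symm
    have := ih (LinearMap.range g)
    exact Module.Projective.of_equiv (LinearEquiv.ofInjective g hg).symm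

/-- Over a left hereditary ring, submodules of finite projective modules are projective. -/
theorem Submodule.projective_of_forall_ideal {S M : Type*} [Ring S] [AddCommGroup M] [Module S M]
    [Module.Finite S M] [Module.Projective S M] (hS : ∀ I : Ideal S, Module.Projective S I)
    (N : Submodule S M) : Module.Projective S N := by
  obtain ⟨n, f, g, -, hg, -⟩ := Module.Finite.exists_comp_eq_id_of_projective S M
  have := Submodule.projective_of_forall_ideal_pi hS n (N.map g)
  exact Module.Projective.of_equiv (Submodule.equivMapOfInjective g hg N).symm

/-- Only finitely many components of a map from a finite module to a direct sum are nonzero. -/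
theorem Finsupp.finite_support_lapply_comp {S M N ι : Type*} [Ring S] [AddCommGroup M] [Module S M]
    [Module.Finite S M] [AddCommGroup N] [Module S N] (f : M →ₗ[S] ι →₀ N) :
    (Function.support fun i ↦ Finsupp.lapply i ∘ₗ f).Finite := by
  classical
  obtain ⟨T, hT⟩ := Module.Finite.fg_top (R := S) (M := M)
  refine (T.biUnion fun x ↦ (f x).support).finite_toSet.subset fun i hi ↦ ?_
  contrapose! hi
  simp only [Finset.coe_biUnion, Set.mem_iUnion, not_exists, Finset.mem_coe,
    Finsupp.notMem_support_iff] at hi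
  rw [Function.notMem_support]
  refine LinearMap.ext_on hT fun x hx ↦ ?_
  simpa using hi x hx

/-- The opposite of the endomorphism ring of a finite module all of whose submodules are projective
is left hereditary. -/
theorem Module.End.projective_ideal_mulOpposite {S P : Type*} [Ring S] [AddCommGroup P] [Module S P]
    [Module.Finite S P] (hP : ∀ N : Submodule S P, Module.Projective S N)
    (I : Ideal (Module.End S P)ᵐᵒᵖ) : Module.Projective (Module.End S P)ᵐᵒᵖ I := by
  let f : (I →₀ P) →ₗ[S] P := Finsupp.lsum ℕ fun g ↦ g.1.unop
  have hf (g : I) (p : P) : g.1.unop p ∈ LinearMap.range f :=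
    ⟨Finsupp.single g p, by simp [f]⟩
  have := hP (LinearMap.range f)
  obtain ⟨s, hs⟩ := Module.projective_lifting_property f.rangeRestrict LinearMap.id
    f.surjective_rangeRestrict
  have hs' (y : LinearMap.range f) : f (s y) = y := congr_arg Subtype.val (LinearMap.congr_fun hs y)
  let c (g : I) : P →ₗ[S] I →₀ P := s ∘ₗ LinearMap.codRestrict _ g.1.unop (hf g)
  let σ : I →ₗ[(Module.End S P)ᵐᵒᵖ] I →₀ (Module.End S P)ᵐᵒᵖ :=
    { toFun g := Finsupp.ofSupportFinite (fun i ↦ MulOpposite.op (Finsupp.lapply i ∘ₗ c g)) <|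
        (Finsupp.finite_support_lapply_comp (c g)).subset fun i hi ↦ by
          simpa [Function.mem_support] using hi
      map_add' g h := by
        have : c (g + h) = c g + c h := by
          ext1 p
          exact map_add s ⟨_, hf g p⟩ ⟨_, hf h p⟩
        ext i : 1
        change MulOpposite.op (Finsupp.lapply i ∘ₗ c (g + h)) =
          MulOpposite.op (Finsupp.lapply i ∘ₗ c g) + MulOpposite.op (Finsupp.lapply i ∘ₗ c h)
        rw [this, LinearMap.comp_add, MulOpposite.op_add]
      map_smul' a g := by
        ext i
        rfl }
  refine Module.Projective.of_split σ (Finsupp.linearCombination _ id) ?_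
  ext g : 1
  apply Subtype.ext
  apply MulOpposite.unop_injective
  ext p
  have h : f (c g p) = g.1.unop p := hs' ⟨_, hf g p⟩
  have hsub : (c g p).support ⊆ (σ g).support := fun i hi ↦ by
    rw [Finsupp.mem_support_iff] at hi ⊢
    exact fun h0 ↦ hi (LinearMap.congr_fun (congr_arg MulOpposite.unop h0) p)
  rw [LinearMap.id_apply, ← h, Finsupp.lsum_apply,
    Finsupp.sum_of_support_subset _ hsub _ fun i _ ↦ map_zero _]
  simp only [LinearMap.comp_apply, Finsupp.linearCombination_apply, Finsupp.sum,
    Submodule.coe_sum, Finset.unop_sum, LinearMap.sum_apply]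
  rfl

/-- Let `R` be a Dedekind domain with fraction field `K`, `A` a
finite-dimensional semisimple `K`-algebra, and `H ⊆ A` a left hereditary `R`-order.
For any finitely generated projective left `H`-module `P`, the minor
`H' = (End_H(P))^op` is again left hereditary. -/
theorem statement8 {R : Type*} [CommRing R] [IsDomain R] [IsDedekindDomain R]
    {K : Type*} [Field K] [Algebra R K] [IsFractionRing R K]
    {A : Type*} [Ring A] [Algebra K A] [FiniteDimensional K A] [IsSemisimpleRing A]
    [Algebra R A] [IsScalarTower R K A]
    (H : Subalgebra R A)
    (hfin : Module.Finite R H)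
    (hspan : Submodule.span K (H : Set A) = ⊤)
    (hher : ∀ I : Ideal H, Module.Projective H I)
    (P : Type*) [AddCommGroup P] [Module H P]
    [Module.Finite H P] [Module.Projective H P] :
    ∀ I : Ideal (Module.End H P)ᵐᵒᵖ, Module.Projective (Module.End H P)ᵐᵒᵖ I :=
  Module.End.projective_ideal_mulOpposite fun N ↦ N.projective_of_forall_ideal hher
end

section
/- Let B be a (possibly noncommutative, unital, associative) ring, P a finitely generated projective left B-module, and A := (End_B(P))^op. For every left B-module X, the abelian group Hom_B(P, X) is a left A-module via (φ^op)·f := f ∘ φ for φ ∈ End_B(P). Then the functor Hom_B(P, −) is essentially surjective onto left A-modules: for every left A-module M there exist a left B-module X and an isomorphism of left A-modules Hom_B(P, X) ≅ M. -/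
/-- The additive group `Hom_A(Hom_B(P, B), M)` of maps linear over `A = (End_B(P))^op`. -/
def coinducedFromDual (B P M : Type u) [Ring B] [AddCommGroup P] [Module B P]
    [AddCommGroup M] [Module (Module.End B P)ᵐᵒᵖ M] : AddSubgroup ((P →ₗ[B] B) →+ M) where
  carrier := {g | ∀ (φ : Module.End B P) (f : P →ₗ[B] B),
    g (f.comp φ) = MulOpposite.op φ • g f}
  zero_mem' := fun φ f => by simp
  add_mem' := fun hg hh φ f => by simp [hg φ f, hh φ f]
  neg_mem' := fun hg φ f => by simp [hg φ f]

namespace coinducedFromDual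

variable {B P M : Type u} [Ring B] [AddCommGroup P] [Module B P]
  [AddCommGroup M] [Module (Module.End B P)ᵐᵒᵖ M]

/-- `b • g` is `g` precomposed with right multiplication by `b` on the dual of `P`. -/
instance : SMul B (coinducedFromDual B P M) where
  smul b g :=
    ⟨g.1.comp (DistribSMul.toAddMonoidHom (P →ₗ[B] B) (MulOpposite.op b)),
      fun φ f => g.2 φ (MulOpposite.op b • f)⟩

theorem smul_apply (b : B) (g : coinducedFromDual B P M) (f : P →ₗ[B] B) :
    (b • g).1 f = g.1 (MulOpposite.op b • f) := rfl

theorem ext {g h : coinducedFromDual B P M} (w : ∀ f, g.1 f = h.1 f) : g = h :=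
  Subtype.ext (AddMonoidHom.ext w)

instance : Module B (coinducedFromDual B P M) where
  one_smul g := ext fun f => by simp [smul_apply]
  mul_smul a b g := ext fun f => by simp [smul_apply, mul_smul]
  smul_zero b := ext fun f => rfl
  smul_add b g h := ext fun f => rfl
  add_smul a b g := ext fun f => by
    change g.1 (MulOpposite.op (a + b) • f) =
      g.1 (MulOpposite.op a • f) + g.1 (MulOpposite.op b • f)
    rw [MulOpposite.op_add, add_smul, map_add]
  zero_smul g := ext fun f => by
    change g.1 (MulOpposite.op (0 : B) • f) = 0
    rw [MulOpposite.op_zero, zero_smul, map_zero]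

/-- The canonical map `M → Hom_B(P, Hom_A(Hom_B(P, B), M))`. -/
def unit : M →+ (P →ₗ[B] coinducedFromDual B P M) where
  toFun m :=
    { toFun := fun p =>
        ⟨{ toFun := fun f => MulOpposite.op (f.smulRight p : Module.End B P) • m
           map_zero' := by
            have : ((0 : P →ₗ[B] B).smulRight p : Module.End B P) = 0 := by ext; simp
            rw [this, MulOpposite.op_zero, zero_smul]
           map_add' := fun f g => by
            have : ((f + g).smulRight p : Module.End B P) =
                f.smulRight p + g.smulRight p := by ext; simp [add_smul]
            rw [this, MulOpposite.op_add, add_smul] },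
          fun φ f => by
            change MulOpposite.op ((f.smulRight p : Module.End B P) * φ) • m = _
            rw [MulOpposite.op_mul, mul_smul]
            rfl⟩
      map_add' := fun p q => ext fun f => by
        change MulOpposite.op (f.smulRight (p + q) : Module.End B P) • m =
          MulOpposite.op (f.smulRight p : Module.End B P) • m +
            MulOpposite.op (f.smulRight q : Module.End B P) • m
        have : (f.smulRight (p + q) : Module.End B P) =
            f.smulRight p + f.smulRight q := by ext; simp
        rw [this, MulOpposite.op_add, add_smul]
      map_smul' := fun b p => ext fun f => by
        change MulOpposite.op (f.smulRight (b • p) : Module.End B P) • m =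
          MulOpposite.op ((MulOpposite.op b • f).smulRight p : Module.End B P) • m
        congr 2
        ext x
        simp [mul_smul] }
  map_zero' := LinearMap.ext fun _ => ext fun _ => smul_zero _
  map_add' _ _ := LinearMap.ext fun _ => ext fun _ => smul_add _ _ _

theorem unit_apply (m : M) (p : P) (f : P →ₗ[B] B) :
    (unit m p).1 f = MulOpposite.op (f.smulRight p : Module.End B P) • m := rfl

theorem unit_op_smul (φ : Module.End B P) (m : M) :
    unit (MulOpposite.op φ • m) = (unit m).comp φ :=
  LinearMap.ext fun p => ext fun f => by
    rw [LinearMap.comp_apply, unit_apply, unit_apply, ← mul_smul, ← MulOpposite.op_mul]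
    congr 2
    ext x
    simp

/-- A finitely generated projective module has a finite dual basis. -/
theorem exists_finite_dual_basis (B P : Type u) [Ring B] [AddCommGroup P] [Module B P]
    [Module.Finite B P] [Module.Projective B P] :
    ∃ (n : ℕ) (p : Fin n → P) (f : Fin n → (P →ₗ[B] B)), ∀ x, ∑ i, f i x • p i = x := by
  obtain ⟨n, g, s, -, -, hgs⟩ := Module.Finite.exists_comp_eq_id_of_projective B P
  refine ⟨n, fun i => g (Pi.single i 1), fun i => (LinearMap.proj i).comp s, fun x => ?_⟩
  have hx : g (s x) = x := LinearMap.congr_fun hgs x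
  conv_rhs => rw [← hx, pi_eq_sum_univ' (s x), map_sum]
  refine Finset.sum_congr rfl fun i _ => ?_
  rw [map_smul]
  congr 2

theorem unit_bijective [Module.Finite B P] [Module.Projective B P] :
    Function.Bijective (unit : M →+ (P →ₗ[B] coinducedFromDual B P M)) := by
  obtain ⟨n, p, f, hpf⟩ := exists_finite_dual_basis B P
  constructor
  · have key (m : M) : ∑ i, (unit m (p i)).1 (f i) = m := by
      have : ∑ i, ((f i).smulRight (p i) : Module.End B P) = 1 := by
        ext x
        simpa using hpf x
      simp only [unit_apply]
      rw [← Finset.sum_smul, ← Finset.op_sum, this, MulOpposite.op_one, one_smul]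
    intro m m' h
    rw [← key m, h, key m']
  · intro h
    refine ⟨∑ i, (h (p i)).1 (f i), LinearMap.ext fun x => ext fun k => ?_⟩
    rw [unit_apply, Finset.smul_sum]
    conv_rhs => rw [← hpf x, map_sum, AddSubgroup.val_finsetSum,
      AddMonoidHom.finsetSum_apply]
    refine Finset.sum_congr rfl fun i _ => ?_
    rw [← (h (p i)).2, map_smul, smul_apply]
    congr 1
    ext y
    simp

end coinducedFromDual


universe u

/-- Let `P` be a finitely generated projective left module over a ring `B`
and `A = (End_B(P))^op`.  The functor `Hom_B(P, −)` is essentially surjective onto left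
`A`-modules: every left `A`-module `M` is isomorphic, as an `A`-module, to `Hom_B(P, X)`
for some left `B`-module `X` (where `φ^op ∈ A` acts on `Hom_B(P, X)` by precomposition
`f ↦ f ∘ φ`). -/
theorem statement12 {B P : Type u} [Ring B] [AddCommGroup P] [Module B P]
    [Module.Finite B P] [Module.Projective B P]
    (M : Type u) [AddCommGroup M] [Module (Module.End B P)ᵐᵒᵖ M] :
    ∃ (X : Type u) (_ : AddCommGroup X) (_ : Module B X)
      (e : M ≃+ (P →ₗ[B] X)),
      ∀ (φ : Module.End B P) (m : M),
        e (MulOpposite.op φ • m) = (e m).comp φ := by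
  exact ⟨coinducedFromDual B P M, inferInstance, inferInstance,
    AddEquiv.ofBijective coinducedFromDual.unit coinducedFromDual.unit_bijective,
    coinducedFromDual.unit_op_smul⟩
end

section
/- Let k be a field, R = k⟦w⟧ the formal power series ring, and m = (w) its maximal ideal. Let B ⊆ Mat₄(R) be the subring of 4×4 matrices M = (M_{ij}) over R satisfying M₁₂ ∈ m, M₂₁ ∈ m, M₃₁, M₃₂ ∈ m, M₄₁, M₄₂ ∈ m (all other entries arbitrary in R), and let A ⊆ Mat₃(R) be the Gelfand order, the subring of 3×3 matrices N = (N_{ij}) over R with N₁₂, N₁₃ ∈ m, N₂₃ ∈ m, N₃₂ ∈ m (all other entries arbitrary in R). Then B and A are Morita equivalent: their categories of left modules are equivalent. -/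
open CategoryTheory

namespace IsIdempotentElem

section Module

variable {R : Type*} [Ring R] {e : R} (he : IsIdempotentElem e)
variable (M : Type*) [AddCommGroup M] [Module R M]

/-- The additive subgroup `eM` of a left `R`-module `M`, for `e` idempotent. -/
def peirce (_ : IsIdempotentElem e) : AddSubgroup M where
  carrier := {m | e • m = m}
  add_mem' {a b} ha hb := by
    rw [Set.mem_ofPred_eq] at *
    rw [smul_add, ha, hb]
  zero_mem' := smul_zero e
  neg_mem' {a} ha := by
    rw [Set.mem_ofPred_eq] at *
    rw [smul_neg, ha]

variable {M}

lemma smul_coe_peirce (m : he.peirce M) : e • (m : M) = m := m.2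

lemma smul_mem_peirce (m : M) : e • m ∈ he.peirce M :=
  show e • e • m = e • m by rw [smul_smul, he.eq]

lemma mul_coe_corner (c : he.Corner) : e * c.1 = c.1 :=
  ((Subsemigroup.mem_corner_iff he).mp c.2).1

lemma coe_corner_mul (c : he.Corner) : c.1 * e = c.1 :=
  ((Subsemigroup.mem_corner_iff he).mp c.2).2

/-- The element `e * r * e` of the corner ring `eRe`. -/
def toCorner (r : R) : he.Corner := ⟨e * r * e, r, rfl⟩

instance : Module he.Corner (he.peirce M) where
  smul c m := ⟨c.1 • m.1, show e • c.1 • m.1 = c.1 • m.1 by rw [smul_smul, mul_coe_corner]⟩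
  one_smul m := Subtype.ext m.2
  mul_smul c d m := Subtype.ext (mul_smul c.1 d.1 m.1)
  smul_zero c := Subtype.ext (smul_zero c.1)
  smul_add c m n := Subtype.ext (smul_add c.1 m.1 n.1)
  add_smul c d m := Subtype.ext (add_smul c.1 d.1 m.1)
  zero_smul m := Subtype.ext (zero_smul R m.1)

@[simp]
lemma coe_smul_peirce (c : he.Corner) (m : he.peirce M) :
    ((c • m : he.peirce M) : M) = c.1 • (m : M) := rfl

@[simp]
lemma coe_toCorner_smul (r : R) (m : he.peirce M) :
    ((he.toCorner r • m : he.peirce M) : M) = (e * r) • (m : M) :=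
  (mul_smul (e * r) e m.1).trans (by rw [smul_coe_peirce])

variable {N : Type*} [AddCommGroup N] [Module R N]

/-- The map `eM → eN` induced by an `R`-linear map `M → N`. -/
def peirceMap (f : M →ₗ[R] N) : he.peirce M →ₗ[he.Corner] he.peirce N where
  toFun m := ⟨f m, show e • f m = f m by rw [← map_smul, smul_coe_peirce]⟩
  map_add' m n := Subtype.ext (map_add f m.1 n.1)
  map_smul' c m := Subtype.ext (map_smul f c.1 m.1)

variable {ι : Type*} [Fintype ι] {x y : ι → R}

/-- If `∑ i, xᵢ e yᵢ = 1`, then every map `eM → eN` of modules over `eRe` extends to an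
`R`-linear map `M → N`. -/
def peirceLift (h : ∑ i, x i * e * y i = 1) (g : he.peirce M →ₗ[he.Corner] he.peirce N) :
    M →ₗ[R] N where
  toFun m := ∑ i, x i • (g ⟨e • y i • m, he.smul_mem_peirce _⟩ : N)
  map_add' m n := by
    rw [← Finset.sum_add_distrib]
    refine Finset.sum_congr rfl fun i _ ↦ ?_
    rw [← smul_add, ← AddSubgroup.coe_add, ← map_add]
    congr 3
    exact Subtype.ext (by simp)
  map_smul' b m := by
    have key (j : ι) : (g ⟨e • y j • b • m, he.smul_mem_peirce _⟩ : N) =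
        ∑ i, (e * y j * b * x i) • (g ⟨e • y i • m, he.smul_mem_peirce _⟩ : N) := by
      have : (⟨e • y j • b • m, he.smul_mem_peirce _⟩ : he.peirce M) =
          ∑ i, he.toCorner (y j * b * x i) •
            ⟨e • y i • m, he.smul_mem_peirce _⟩ := by
        refine Subtype.ext ?_
        rw [AddSubgroup.val_finsetSum]
        simp only [coe_toCorner_smul, smul_smul]
        rw [← Finset.sum_smul]
        congr 1
        calc e * (y j * b) = e * (y j * b) * ∑ i, x i * e * y i := by rw [h, mul_one]
          _ = _ := by simp only [Finset.mul_sum, mul_assoc]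
      rw [this, map_sum, AddSubgroup.val_finsetSum]
      simp only [map_smul, coe_toCorner_smul, mul_assoc]
    simp only [key, RingHom.id_apply, Finset.smul_sum]
    rw [Finset.sum_comm]
    refine Finset.sum_congr rfl fun i _ ↦ ?_
    generalize g ⟨e • y i • m, he.smul_mem_peirce _⟩ = n
    calc _ = ((∑ j, x j * e * y j) * (b * x i)) • (n : N) := by
          simp only [smul_smul, ← Finset.sum_smul, Finset.sum_mul, mul_assoc]
      _ = _ := by rw [h, one_mul, mul_smul]

lemma peirceMap_peirceLift (h : ∑ i, x i * e * y i = 1)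
    (g : he.peirce M →ₗ[he.Corner] he.peirce N) : he.peirceMap (he.peirceLift h g) = g := by
  ext m
  have (i : ι) : (⟨e • y i • m.1, he.smul_mem_peirce _⟩ : he.peirce M) =
      he.toCorner (y i) • m :=
    Subtype.ext ((he.coe_toCorner_smul (y i) m).trans (mul_smul _ _ _)).symm
  calc ∑ i, x i • (g ⟨e • y i • m.1, he.smul_mem_peirce _⟩ : N)
      = ∑ i, (x i * e * y i) • (g m : N) := by
        refine Finset.sum_congr rfl fun i _ ↦ ?_
        rw [this, map_smul, coe_toCorner_smul]
        simp only [mul_smul]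
    _ = g m := by rw [← Finset.sum_smul, h, one_smul]

lemma peirceMap_injective (h : ∑ i, x i * e * y i = 1) :
    Function.Injective (he.peirceMap : (M →ₗ[R] N) → _) := by
  intro f g hfg
  ext m
  have key (i : ι) : f (e • y i • m) = g (e • y i • m) :=
    congrArg Subtype.val (LinearMap.congr_fun hfg ⟨e • y i • m, he.smul_mem_peirce _⟩)
  calc f m = f (∑ i, x i • e • y i • m) := by
        simp only [smul_smul, ← mul_assoc, ← Finset.sum_smul, h, one_smul]
    _ = g (∑ i, x i • e • y i • m) := by simp only [map_sum, map_smul _ (x _), key]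
    _ = g m := by simp only [smul_smul, ← mul_assoc, ← Finset.sum_smul, h, one_smul]

end Module

section Coinduced

variable {R : Type*} [Ring R] {e : R} (he : IsIdempotentElem e)
variable (N : Type*) [AddCommGroup N] [Module he.Corner N]

/-- The group `Hom_{eRe}(eR, N)`, on which `R` acts through right multiplication on `eR`. -/
def Coinduced : Type _ := he.peirce R →ₗ[he.Corner] N

instance : AddCommGroup (he.Coinduced N) :=
  inferInstanceAs (AddCommGroup (he.peirce R →ₗ[he.Corner] N))

/-- Right multiplication by `r` as an endomorphism of the left `eRe`-module `eR`. -/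
def peirceMulRight (r : R) : he.peirce R →ₗ[he.Corner] he.peirce R :=
  he.peirceMap (LinearMap.toSpanSingleton R R r)

instance : Module R (he.Coinduced N) where
  smul r φ := LinearMap.comp φ (he.peirceMulRight r)
  one_smul φ := LinearMap.ext fun a ↦ congrArg (DFunLike.coe (F := _ →ₗ[he.Corner] N) φ)
    (Subtype.ext (mul_one a.1))
  mul_smul r s φ := LinearMap.ext fun a ↦ congrArg (DFunLike.coe (F := _ →ₗ[he.Corner] N) φ)
    (Subtype.ext (mul_assoc a.1 r s).symm)
  smul_zero _ := rfl
  smul_add _ _ _ := rfl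
  add_smul r s φ := LinearMap.ext fun a ↦
    (congrArg (DFunLike.coe (F := _ →ₗ[he.Corner] N) φ)
      (Subtype.ext (mul_add a.1 r s) :
        he.peirceMulRight (r + s) a = he.peirceMulRight r a + he.peirceMulRight s a)).trans
      (LinearMap.map_add φ _ _)
  zero_smul φ := LinearMap.ext fun a ↦
    (congrArg (DFunLike.coe (F := _ →ₗ[he.Corner] N) φ)
      (Subtype.ext (mul_zero a.1) : he.peirceMulRight 0 a = 0)).trans (LinearMap.map_zero φ)

variable {N}

instance : FunLike (he.Coinduced N) (he.peirce R) N :=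
  inferInstanceAs (FunLike (he.peirce R →ₗ[he.Corner] N) (he.peirce R) N)

instance : LinearMapClass (he.Coinduced N) he.Corner (he.peirce R) N :=
  inferInstanceAs (LinearMapClass (he.peirce R →ₗ[he.Corner] N) he.Corner (he.peirce R) N)

lemma coinduced_smul_apply (r : R) (φ : he.Coinduced N) (a : he.peirce R) :
    (r • φ) a = φ (he.peirceMulRight r a) := rfl

/-- The generator `e` of the module `eR`. -/
def peirceOne : he.peirce R := ⟨e, he.eq⟩

/-- Evaluation at `e`, as an `eRe`-linear map `e Hom_{eRe}(eR, N) → N`. -/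
def coinducedEval : he.peirce (he.Coinduced N) →ₗ[he.Corner] N where
  toFun φ := φ.1 he.peirceOne
  map_add' φ ψ := rfl
  map_smul' c φ := by
    rw [coe_smul_peirce, coinduced_smul_apply, RingHom.id_apply, ← map_smul]
    congr 1
    exact Subtype.ext ((he.mul_coe_corner c).trans (he.coe_corner_mul c).symm)

lemma coinduced_apply_eq (φ : he.peirce (he.Coinduced N)) (a : he.peirce R) :
    φ.1 a = he.toCorner a.1 • he.coinducedEval φ := by
  have ha : e * a.1 = a.1 := a.2
  conv_lhs => rw [← he.smul_coe_peirce φ]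
  rw [coinduced_smul_apply]
  change _ = _ • φ.1 he.peirceOne
  rw [← map_smul]
  congr 1
  refine Subtype.ext ?_
  change a.1 * e = e * a.1 * e * e
  rw [ha, mul_assoc, he.eq]

lemma coinducedEval_bijective :
    Function.Bijective (he.coinducedEval : he.peirce (he.Coinduced N) → N) := by
  refine ⟨fun φ ψ h ↦ Subtype.ext (LinearMap.ext fun a ↦ ?_), fun n ↦ ?_⟩
  · exact (he.coinduced_apply_eq φ a).trans (h ▸ (he.coinduced_apply_eq ψ a).symm)
  · let p : he.peirce R →ₗ[he.Corner] he.Corner :=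
      { toFun a := he.toCorner a.1
        map_add' a b := Subtype.ext (show e * (a.1 + b.1) * e = e * a.1 * e + e * b.1 * e by
          rw [mul_add, add_mul])
        map_smul' c a := Subtype.ext (show e * (c.1 * a.1) * e = c.1 * (e * a.1 * e) by
          simp only [← mul_assoc]
          rw [he.mul_coe_corner, he.coe_corner_mul]) }
    let φ : he.Coinduced N := LinearMap.comp (LinearMap.toSpanSingleton he.Corner N n) p
    have hφ (a : he.peirce R) : φ a = he.toCorner a.1 • n := rfl
    refine ⟨⟨φ, LinearMap.ext fun a ↦ ?_⟩, ?_⟩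
    · change φ _ = φ a
      rw [hφ, hφ]
      congr 1
      refine Subtype.ext ?_
      change e * (a.1 * e) * e = e * a.1 * e
      rw [← mul_assoc, mul_assoc _ e e, he.eq]
    · change φ he.peirceOne = n
      rw [hφ]
      convert one_smul he.Corner n
      refine Subtype.ext ?_
      change e * e * e = e
      rw [he.eq, he.eq]

end Coinduced

universe v

variable {R : Type v} [Ring R] {e : R} (he : IsIdempotentElem e)

/-- The functor `M ↦ eM` from left `R`-modules to left `eRe`-modules. -/
def peirceFunctor : ModuleCat.{v} R ⥤ ModuleCat.{v} he.Corner where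
  obj M := ModuleCat.of he.Corner (he.peirce M)
  map f := ModuleCat.ofHom (he.peirceMap f.hom)

/-- For a full idempotent `e` of `R`, the functor `M ↦ eM` is an equivalence from left
`R`-modules to left `eRe`-modules. -/
lemma isEquivalence_peirceFunctor {ι : Type*} [Fintype ι] {x y : ι → R}
    (h : ∑ i, x i * e * y i = 1) : he.peirceFunctor.IsEquivalence where
  faithful := ⟨fun hfg ↦ ModuleCat.hom_ext
    (he.peirceMap_injective h (congrArg ModuleCat.Hom.hom hfg))⟩
  full := ⟨fun g ↦ ⟨ModuleCat.ofHom (he.peirceLift h g.hom),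
    ModuleCat.hom_ext (he.peirceMap_peirceLift h g.hom)⟩⟩
  essSurj := ⟨fun N ↦ ⟨ModuleCat.of R (he.Coinduced N),
    ⟨(LinearEquiv.ofBijective he.coinducedEval he.coinducedEval_bijective).toModuleIso⟩⟩⟩

end IsIdempotentElem

namespace Matrix

variable {R : Type*} [CommRing R] {n n' : Type*} [DecidableEq n]

/-- The matrix over `R` of the inclusion of coordinates along `f`. -/
def inclusion (R : Type*) [CommRing R] (f : n' → n) : Matrix n n' R :=
  (1 : Matrix n n R).submatrix id f

lemma inclusion_mul_mul_transpose_mem [Fintype n'] {I : Ideal R} {f : n' → n}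
    {N : Matrix n' n' R} {i j : n} (h : ∀ a b, f a = i → f b = j → N a b ∈ I) :
    (inclusion R f * N * (inclusion R f)ᵀ) i j ∈ I := by
  simp only [mul_apply]
  refine I.sum_mem fun b _ ↦ ?_
  by_cases hb : j = f b
  · refine I.mul_mem_right _ (I.sum_mem fun a _ ↦ ?_)
    by_cases ha : i = f a
    · exact I.mul_mem_left _ (h a b ha.symm hb.symm)
    · simp [inclusion, ha]
  · simp [inclusion, one_apply, hb]

variable [Fintype n]

/-- The ring of square matrices over `R` whose entries at the positions in `P` lie in `I`. -/
def tiledOrder (I : Ideal R) (P : n → n → Prop) (h₁ : ∀ i, ¬ P i i)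
    (h₂ : ∀ i j k, P i k → P i j ∨ P j k) : Subring (Matrix n n R) where
  carrier := {M | ∀ i j, P i j → M i j ∈ I}
  mul_mem' {M N} hM hN i k hik := I.sum_mem fun j _ ↦ (h₂ i j k hik).elim
    (fun h ↦ I.mul_mem_right _ (hM i j h)) (fun h ↦ I.mul_mem_left _ (hN j k h))
  one_mem' i j hij := by
    have hne : i ≠ j := by
      rintro rfl
      exact h₁ i hij
    rw [one_apply_ne hne]
    exact I.zero_mem
  add_mem' hM hN i j hij := I.add_mem (hM i j hij) (hN i j hij)
  zero_mem' _ _ _ := I.zero_mem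
  neg_mem' hM i j hij := I.neg_mem (hM i j hij)

lemma inclusion_transpose_mul_self [DecidableEq n'] {f : n' → n} (hf : Function.Injective f) :
    (inclusion R f)ᵀ * inclusion R f = 1 := by
  ext a b
  simp [inclusion, mul_apply, one_apply, hf.eq_iff]

lemma transpose_inclusion_mul_mul_inclusion (f : n' → n) (M : Matrix n n R) :
    (inclusion R f)ᵀ * M * inclusion R f = M.submatrix f f := by
  ext a b
  simp [inclusion, mul_apply, one_apply]

variable [Fintype n'] {I : Ideal R} {P : n → n → Prop} {h₁ : ∀ i, ¬ P i i}
  {h₂ : ∀ i j k, P i k → P i j ∨ P j k} {P' : n' → n' → Prop} {h₁' : ∀ i, ¬ P' i i}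
  {h₂' : ∀ i j k, P' i k → P' i j ∨ P' j k}

lemma single_one_mem_tiledOrder {i j : n} (hij : ¬ P i j) :
    single i j 1 ∈ tiledOrder I P h₁ h₂ := by
  intro p q hpq
  rw [single_apply_of_ne]
  · exact I.zero_mem
  · rintro ⟨rfl, rfl⟩
    exact hij hpq

variable [DecidableEq n']

lemma inclusion_mul_transpose_mem_tiledOrder (f : n' → n) :
    inclusion R f * (inclusion R f)ᵀ ∈ tiledOrder I P h₁ h₂ := by
  intro i j hij
  have h : (inclusion R f * (1 : Matrix n' n' R) * (inclusion R f)ᵀ) i j ∈ I := by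
    refine inclusion_mul_mul_transpose_mem fun a b ha hb ↦ ?_
    have hne : a ≠ b := by
      rintro rfl
      exact h₁ i ((ha.symm.trans hb) ▸ hij)
    rw [one_apply_ne hne]
    exact I.zero_mem
  rwa [Matrix.mul_one] at h

variable (I h₁ h₂) in
/-- The diagonal idempotent of a tiled order supported on the range of `f`. -/
def tiledIdempotent (f : n' → n) : tiledOrder I P h₁ h₂ :=
  ⟨inclusion R f * (inclusion R f)ᵀ, inclusion_mul_transpose_mem_tiledOrder f⟩

lemma isIdempotentElem_tiledIdempotent {f : n' → n} (hf : Function.Injective f) :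
    IsIdempotentElem (tiledIdempotent I h₁ h₂ f) := by
  refine Subtype.ext ?_
  change inclusion R f * (inclusion R f)ᵀ * (inclusion R f * (inclusion R f)ᵀ) = _
  rw [Matrix.mul_assoc, ← Matrix.mul_assoc _ (inclusion R f), inclusion_transpose_mul_self hf,
    Matrix.one_mul]
  rfl

/-- The corner of a tiled order at the diagonal idempotent supported on the range of `f` is the
tiled order obtained by restriction along `f`. -/
def cornerTiledOrderEquiv {f : n' → n} (hf : Function.Injective f)
    (hP : ∀ a b, P' a b ↔ P (f a) (f b)) :
    (isIdempotentElem_tiledIdempotent (I := I) (h₁ := h₁) (h₂ := h₂) hf).Corner ≃+*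
      tiledOrder I P' h₁' h₂' where
  toFun c := ⟨(inclusion R f)ᵀ * c.1.1 * inclusion R f, fun a b hab ↦ by
    rw [transpose_inclusion_mul_mul_inclusion]
    exact c.1.2 _ _ ((hP a b).mp hab)⟩
  invFun N := ⟨⟨inclusion R f * N.1 * (inclusion R f)ᵀ, fun i j hij ↦
      inclusion_mul_mul_transpose_mem fun a b ha hb ↦
        N.2 a b ((hP a b).mpr (ha.symm ▸ hb.symm ▸ hij))⟩, by
    rw [Subsemigroup.mem_corner_iff (isIdempotentElem_tiledIdempotent hf)]
    constructor <;> refine Subtype.ext ?_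
    · change inclusion R f * (inclusion R f)ᵀ * (inclusion R f * N.1 * (inclusion R f)ᵀ) =
        inclusion R f * N.1 * (inclusion R f)ᵀ
      simp only [Matrix.mul_assoc]
      rw [← Matrix.mul_assoc _ (inclusion R f), inclusion_transpose_mul_self hf, Matrix.one_mul]
    · change inclusion R f * N.1 * (inclusion R f)ᵀ * (inclusion R f * (inclusion R f)ᵀ) =
        inclusion R f * N.1 * (inclusion R f)ᵀ
      rw [Matrix.mul_assoc _ _ (_ * _), ← Matrix.mul_assoc _ (inclusion R f),
        inclusion_transpose_mul_self hf, Matrix.one_mul]⟩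
  left_inv c := by
    refine Subtype.ext (Subtype.ext ?_)
    have h : inclusion R f * (inclusion R f)ᵀ * c.1.1 = c.1.1 :=
      congrArg Subtype.val ((isIdempotentElem_tiledIdempotent hf).mul_coe_corner c)
    have h' : c.1.1 * (inclusion R f * (inclusion R f)ᵀ) = c.1.1 :=
      congrArg Subtype.val ((isIdempotentElem_tiledIdempotent hf).coe_corner_mul c)
    calc inclusion R f * ((inclusion R f)ᵀ * c.1.1 * inclusion R f) * (inclusion R f)ᵀ
        = inclusion R f * (inclusion R f)ᵀ * c.1.1 * (inclusion R f * (inclusion R f)ᵀ) := by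
          simp only [Matrix.mul_assoc]
      _ = c.1.1 := by rw [h, h']
  right_inv N := by
    refine Subtype.ext ?_
    calc (inclusion R f)ᵀ * (inclusion R f * N.1 * (inclusion R f)ᵀ) * inclusion R f
        = (inclusion R f)ᵀ * inclusion R f * N.1 * ((inclusion R f)ᵀ * inclusion R f) := by
          simp only [Matrix.mul_assoc]
      _ = N.1 := by rw [inclusion_transpose_mul_self hf, Matrix.one_mul, Matrix.mul_one]
  map_mul' c d := by
    refine Subtype.ext ?_
    have h : inclusion R f * (inclusion R f)ᵀ * d.1.1 = d.1.1 :=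
      congrArg Subtype.val ((isIdempotentElem_tiledIdempotent hf).mul_coe_corner d)
    calc (inclusion R f)ᵀ * (c.1.1 * d.1.1) * inclusion R f
        = (inclusion R f)ᵀ * (c.1.1 * (inclusion R f * (inclusion R f)ᵀ * d.1.1)) *
            inclusion R f := by rw [h]
      _ = ((inclusion R f)ᵀ * c.1.1 * inclusion R f) *
            ((inclusion R f)ᵀ * d.1.1 * inclusion R f) := by simp only [Matrix.mul_assoc]
  map_add' c d := by
    refine Subtype.ext ?_
    change (inclusion R f)ᵀ * (c.1.1 + d.1.1) * inclusion R f =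
      (inclusion R f)ᵀ * c.1.1 * inclusion R f + (inclusion R f)ᵀ * d.1.1 * inclusion R f
    rw [Matrix.mul_add, Matrix.add_mul]

/-- If every index is linked to the range of `f` by units of the tiled order in both directions,
then the idempotent supported on the range of `f` is full. -/
lemma sum_single_mul_tiledIdempotent_mul_single {f : n' → n} (hf : Function.Injective f)
    (r : n → n') (hr : ∀ i, ¬ P i (f (r i))) (hr' : ∀ i, ¬ P (f (r i)) i) :
    ∑ i, (⟨single i (f (r i)) 1, single_one_mem_tiledOrder (hr i)⟩ : tiledOrder I P h₁ h₂) *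
      tiledIdempotent I h₁ h₂ f *
      ⟨single (f (r i)) i 1, single_one_mem_tiledOrder (hr' i)⟩ = 1 := by
  refine Subtype.ext ?_
  rw [AddSubmonoidClass.coe_finsetSum]
  calc ∑ i, single i (f (r i)) 1 * (inclusion R f * (inclusion R f)ᵀ) * single (f (r i)) i 1
      = ∑ i, single i i (1 : R) := Finset.sum_congr rfl fun i _ ↦ by
        rw [single_mul_mul_single]
        simp [inclusion, mul_apply, one_apply, hf.eq_iff]
    _ = 1 := sum_single_one

universe v

/-- A tiled order is Morita equivalent to its restriction along `f`, provided that every index is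
linked to the range of `f` in both directions. -/
theorem nonempty_moduleCat_tiledOrder_equivalence {R : Type v} [CommRing R] {n n' : Type}
    [Fintype n] [DecidableEq n] [Fintype n'] [DecidableEq n'] (I : Ideal R)
    {P : n → n → Prop} (h₁ : ∀ i, ¬ P i i) (h₂ : ∀ i j k, P i k → P i j ∨ P j k)
    {P' : n' → n' → Prop} (h₁' : ∀ i, ¬ P' i i) (h₂' : ∀ i j k, P' i k → P' i j ∨ P' j k)
    {f : n' → n} (hf : Function.Injective f) (hP : ∀ a b, P' a b ↔ P (f a) (f b))
    (r : n → n') (hr : ∀ i, ¬ P i (f (r i))) (hr' : ∀ i, ¬ P (f (r i)) i) :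
    Nonempty (ModuleCat.{v} (tiledOrder I P h₁ h₂) ≌
      ModuleCat.{v} (tiledOrder I P' h₁' h₂')) := by
  have := (isIdempotentElem_tiledIdempotent hf).isEquivalence_peirceFunctor
    (sum_single_mul_tiledIdempotent_mul_single (I := I) (h₁ := h₁) (h₂ := h₂) hf r hr hr')
  exact ⟨(isIdempotentElem_tiledIdempotent hf).peirceFunctor.asEquivalence.trans
    (ModuleCat.restrictScalarsEquivalenceOfRingEquiv (cornerTiledOrderEquiv hf hP).symm)⟩

end Matrix

/-- Let `R = k⟦w⟧` with maximal ideal `m = (w)`.  The order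
`B ⊆ Mat₄(R)` (entries `M₀₁, M₁₀, M₂₀, M₂₁, M₃₀, M₃₁` in `m`, all others in `R`) and the
Gelfand order `A ⊆ Mat₃(R)` (entries `N₀₁, N₀₂, N₁₂, N₂₁` in `m`, all others in `R`) are
Morita equivalent: their categories of left modules are equivalent. -/
theorem statement17 {k : Type u} [Field k] :
    ∃ (Bsub : Subring (Matrix (Fin 4) (Fin 4) (PowerSeries k)))
      (Asub : Subring (Matrix (Fin 3) (Fin 3) (PowerSeries k))),
      ((Bsub : Set (Matrix (Fin 4) (Fin 4) (PowerSeries k))) =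
        {M | M 0 1 ∈ Ideal.span {(PowerSeries.X : PowerSeries k)} ∧
             M 1 0 ∈ Ideal.span {(PowerSeries.X : PowerSeries k)} ∧
             M 2 0 ∈ Ideal.span {(PowerSeries.X : PowerSeries k)} ∧
             M 2 1 ∈ Ideal.span {(PowerSeries.X : PowerSeries k)} ∧
             M 3 0 ∈ Ideal.span {(PowerSeries.X : PowerSeries k)} ∧
             M 3 1 ∈ Ideal.span {(PowerSeries.X : PowerSeries k)}}) ∧
      ((Asub : Set (Matrix (Fin 3) (Fin 3) (PowerSeries k))) =
        {N | N 0 1 ∈ Ideal.span {(PowerSeries.X : PowerSeries k)} ∧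
             N 0 2 ∈ Ideal.span {(PowerSeries.X : PowerSeries k)} ∧
             N 1 2 ∈ Ideal.span {(PowerSeries.X : PowerSeries k)} ∧
             N 2 1 ∈ Ideal.span {(PowerSeries.X : PowerSeries k)}}) ∧
      Nonempty (ModuleCat.{u} Bsub ≌ ModuleCat.{u} Asub) := by
  let P : Fin 4 → Fin 4 → Prop := fun i j ↦
    (i, j) ∈ ({(0, 1), (1, 0), (2, 0), (2, 1), (3, 0), (3, 1)} : Finset (Fin 4 × Fin 4))
  let P' : Fin 3 → Fin 3 → Prop := fun i j ↦
    (i, j) ∈ ({(0, 1), (0, 2), (1, 2), (2, 1)} : Finset (Fin 3 × Fin 3))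
  have h₁ : ∀ i, ¬ P i i := by decide
  have h₂ : ∀ i j k, P i k → P i j ∨ P j k := by decide
  have h₁' : ∀ i, ¬ P' i i := by decide
  have h₂' : ∀ i j k, P' i k → P' i j ∨ P' j k := by decide
  refine ⟨Matrix.tiledOrder (Ideal.span {PowerSeries.X}) P h₁ h₂,
    Matrix.tiledOrder (Ideal.span {PowerSeries.X}) P' h₁' h₂', ?_, ?_,
    Matrix.nonempty_moduleCat_tiledOrder_equivalence _ h₁ h₂ h₁' h₂' (f := ![2, 0, 1])
      (by decide) (by decide) ![1, 2, 0, 0] (by decide) (by decide)⟩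
  · ext M
    change (∀ i j, P i j → M i j ∈ _) ↔ _
    simp [P, Fin.forall_fin_succ, and_assoc]
  · ext N
    change (∀ i j, P' i j → N i j ∈ _) ↔ _
    simp [P', Fin.forall_fin_succ, and_assoc]
end
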